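/- Let {X(s)}_{s≥0} be a centered, sample-path continuous Gaussian process with covariance kernel R(s,t) satisfying assumption (i) (self-similarity of the kernel with exponent ρ > 0) and assumption (ii) (logarithmic decay of h with exponent η > 0). Then almost surely limsup_{s→∞} X(s)/√(2 s^{2ρ} log log s) = R(1,1)^{1/2}, and almost surely limsup_{s→∞} (−X(s))/√(2 s^{2ρ} log log s) = R(1,1)^{1/2}. -/

import Mathlib

open MeasureTheory ProbabilityTheory Filter Asymptotics

noncomputable section

/-- A centered Gaussian process on `[0,∞)`: every finite linear combination of the
values of the process at nonnegative times has a centered Gaussian distribution. -/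
def IsCenteredGaussianProcess {Ω : Type*} [MeasurableSpace Ω] (P : Measure Ω)
    (X : ℝ → Ω → ℝ) : Prop :=
  (∀ s : ℝ, Measurable (X s)) ∧
    ∀ (k : ℕ) (t : Fin k → ℝ) (c : Fin k → ℝ), (∀ i, 0 ≤ t i) →
      ∃ v : NNReal,
        Measure.map (fun ω => ∑ i, c i * X (t i) ω) P = gaussianReal 0 v

section

variable {Ω : Type*} [MeasurableSpace Ω]

/-- Chernoff bound for a centered real Gaussian measure. -/
lemma gaussianReal_Ici_le_exp {v w : NNReal} (hvw : v ≤ w) {t : ℝ} (ht : 0 ≤ t) :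
    (gaussianReal 0 v).real (Set.Ici t) ≤ Real.exp (-t ^ 2 / (2 * w)) := by
  have h : HasSubgaussianMGF id w (gaussianReal 0 v) :=
    ⟨fun s => integrable_exp_mul_gaussianReal s, fun s => by
      simp only [mgf_id_gaussianReal, zero_mul, zero_add]
      gcongr⟩
  simpa using! h.measure_ge_le ht

lemma gaussianPDFReal_add_one_le_gaussianReal_Ioi {l : ℝ} (hl : 0 ≤ l) :
    gaussianPDFReal 0 1 (l + 1) ≤ (gaussianReal 0 1).real (Set.Ioi l) := by
  have h1 : ENNReal.ofReal (gaussianPDFReal 0 1 (l + 1)) ≤ gaussianReal 0 1 (Set.Ioi l) := by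
    calc ENNReal.ofReal (gaussianPDFReal 0 1 (l + 1))
        = ∫⁻ _ in Set.Ioo l (l + 1), ENNReal.ofReal (gaussianPDFReal 0 1 (l + 1)) := by simp
      _ ≤ ∫⁻ x in Set.Ioo l (l + 1), gaussianPDF 0 1 x := by
          refine setLIntegral_mono (measurable_gaussianPDF 0 1) fun x hx => ?_
          rw [gaussianPDF]
          refine ENNReal.ofReal_le_ofReal ?_
          simp only [gaussianPDFReal, sub_zero]
          have : x ^ 2 ≤ (l + 1) ^ 2 := by nlinarith [hx.1, hx.2]
          gcongr
      _ = gaussianReal 0 1 (Set.Ioo l (l + 1)) := (gaussianReal_apply 0 one_ne_zero _).symm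
      _ ≤ gaussianReal 0 1 (Set.Ioi l) := measure_mono fun x hx => hx.1
  exact (ENNReal.ofReal_le_iff_le_toReal (measure_ne_top _ _)).1 h1

/-- Lowering the threshold `l` by `d` multiplies the Gaussian tail by at most `exp (2 l d)`, up to
a negligible error. -/
lemma gaussianReal_Ioi_sub_le {l d : ℝ} (hl : 0 ≤ l) (hd : 0 ≤ d) (hdl : d ≤ l / 2) :
    (gaussianReal 0 1).real (Set.Ioi (l - d)) ≤
      Real.exp (2 * l * d) * (gaussianReal 0 1).real (Set.Ioi l)
        + Real.exp (-(9 / 8) * l ^ 2) := by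
  have hshift (s : Set ℝ) (hs : MeasurableSet s) :
      gaussianReal 0 1 ((fun x => x + d) ⁻¹' s) = gaussianReal d 1 s := by
    rw [← Measure.map_apply (by fun_prop) hs, gaussianReal_map_add_const, zero_add]
  have hcore : gaussianReal d 1 (Set.Ioo l (2 * l)) ≤
      ENNReal.ofReal (Real.exp (2 * l * d)) * gaussianReal 0 1 (Set.Ioi l) := by
    calc gaussianReal d 1 (Set.Ioo l (2 * l))
        = ∫⁻ x in Set.Ioo l (2 * l), gaussianPDF d 1 x := gaussianReal_apply d one_ne_zero _
      _ ≤ ∫⁻ x in Set.Ioo l (2 * l),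
            ENNReal.ofReal (Real.exp (2 * l * d)) * gaussianPDF 0 1 x := by
          refine setLIntegral_mono (by fun_prop) fun x hx => ?_
          rw [gaussianPDF, gaussianPDF, ← ENNReal.ofReal_mul (Real.exp_pos _).le]
          refine ENNReal.ofReal_le_ofReal ?_
          simp only [gaussianPDFReal, sub_zero, NNReal.coe_one, mul_one]
          rw [mul_left_comm, ← Real.exp_add]
          gcongr
          nlinarith [hx.1, hx.2, mul_nonneg hd (sub_nonneg.2 hx.2.le)]
      _ = ENNReal.ofReal (Real.exp (2 * l * d)) * gaussianReal 0 1 (Set.Ioo l (2 * l)) := by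
          rw [lintegral_const_mul _ (measurable_gaussianPDF 0 1),
            gaussianReal_apply 0 one_ne_zero]
      _ ≤ _ := by
          gcongr
          exact fun x hx => hx.1
  have hcore' : (gaussianReal d 1).real (Set.Ioo l (2 * l)) ≤
      Real.exp (2 * l * d) * (gaussianReal 0 1).real (Set.Ioi l) := by
    have := ENNReal.toReal_mono (by finiteness) hcore
    rwa [ENNReal.toReal_mul, ENNReal.toReal_ofReal (Real.exp_pos _).le] at this
  have hsplit : Set.Ioi (l - d) ⊆
      ((fun x => x + d) ⁻¹' Set.Ioo l (2 * l)) ∪ Set.Ici (2 * l - d) := by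
    intro x hx
    simp only [Set.mem_Ioi] at hx
    by_cases h : x + d < 2 * l
    · exact Or.inl ⟨by linarith, h⟩
    · exact Or.inr (by simp only [Set.mem_Ici]; linarith)
  refine (measureReal_mono hsplit).trans ((measureReal_union_le _ _).trans ?_)
  gcongr
  · rw [measureReal_def, hshift _ measurableSet_Ioo]
    exact hcore'
  · refine (gaussianReal_Ici_le_exp (le_refl 1) (by linarith)).trans ?_
    gcongr
    simp only [NNReal.coe_one]
    nlinarith

/-- A centered Gaussian of variance at most one has smaller upper tails than the standard one. -/
lemma gaussianReal_Ioi_le_of_le_one {v : NNReal} (hv : v ≤ 1) {t : ℝ} (ht : 0 ≤ t) :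
    (gaussianReal 0 v).real (Set.Ioi t) ≤ (gaussianReal 0 1).real (Set.Ioi t) := by
  have hmap : (gaussianReal 0 1).map (fun x => Real.sqrt v * x) = gaussianReal 0 v := by
    rw [gaussianReal_map_const_mul]
    congr 1
    · simp
    · ext; simp
  rw [← hmap, measureReal_def, Measure.map_apply (by fun_prop) measurableSet_Ioi]
  refine ENNReal.toReal_mono (by finiteness) (measure_mono fun x hx => ?_)
  simp only [Set.mem_preimage, Set.mem_Ioi] at hx ⊢
  have h1 : Real.sqrt v ≤ 1 := Real.sqrt_le_one.2 (by exact_mod_cast hv)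
  have h0 := Real.sqrt_nonneg (v : ℝ)
  rcases le_or_gt x 0 with hx0 | hx0
  · nlinarith [mul_nonneg h0 (neg_nonneg.2 hx0)]
  · nlinarith

/-- Second moment bound: nearly pairwise independent events of probability `p` rarely all fail. -/
lemma measureReal_iInter_compl_le {ι : Type*} (P : Measure Ω) [IsProbabilityMeasure P]
    (s : Finset ι) (A : ι → Set Ω) (hA : ∀ i, MeasurableSet (A i)) {p q : ℝ} (hp : 0 < p)
    (hq : 0 ≤ q) (hs : s.Nonempty) (hAp : ∀ i ∈ s, P.real (A i) = p)
    (hAq : ∀ i ∈ s, ∀ j ∈ s, i ≠ j → P.real (A i ∩ A j) ≤ q) :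
    P.real {ω | ∀ i ∈ s, ω ∉ A i} ≤ 1 / (s.card * p) + (q / p ^ 2 - 1) := by
  classical
  set M : ℝ := (s.card : ℝ) with hM
  have hMpos : 0 < M := by simpa [hM] using hs.card_pos
  let f : ι → Ω → ℝ := fun i => (A i).indicator 1
  have hf (i) : Integrable (f i) P := (integrable_const (1 : ℝ)).indicator (hA i)
  have hff (i j) : f i * f j = (A i ∩ A j).indicator 1 := by
    rw [Set.inter_indicator_one]
  have hffi (i j) : Integrable (fun ω => f i ω * f j ω) P := by
    change Integrable (f i * f j) P
    rw [hff]
    exact (integrable_const (1 : ℝ)).indicator ((hA i).inter (hA j))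
  have hEf (i) : ∫ ω, f i ω ∂P = P.real (A i) := integral_indicator_one (hA i)
  have hEff (i j) : ∫ ω, f i ω * f j ω ∂P = P.real (A i ∩ A j) := by
    have := integral_indicator_one (μ := P) ((hA i).inter (hA j))
    rw [← this, ← hff]; rfl
  have hexp (ω : Ω) : (∑ i ∈ s, f i ω - M * p) ^ 2 =
      ∑ i ∈ s, ∑ j ∈ s, f i ω * f j ω - 2 * M * p * ∑ i ∈ s, f i ω + (M * p) ^ 2 := by
    rw [← Finset.sum_mul_sum]; ring
  have hI1 : Integrable (fun ω => ∑ i ∈ s, ∑ j ∈ s, f i ω * f j ω) P :=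
    integrable_finsetSum _ fun i _ => integrable_finsetSum _ fun j _ => hffi i j
  have hI2 : Integrable (fun ω => 2 * M * p * ∑ i ∈ s, f i ω) P :=
    (integrable_finsetSum _ fun i _ => hf i).const_mul _
  have hint : Integrable (fun ω => (∑ i ∈ s, f i ω - M * p) ^ 2) P := by
    simp_rw [hexp]
    exact (hI1.sub hI2).add (integrable_const _)
  have hsum : ∑ i ∈ s, ∑ j ∈ s, P.real (A i ∩ A j) ≤ M * p + M ^ 2 * q := by
    calc ∑ i ∈ s, ∑ j ∈ s, P.real (A i ∩ A j)
        ≤ ∑ i ∈ s, ∑ j ∈ s, ((if i = j then p else 0) + q) := by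
          refine Finset.sum_le_sum fun i hi => Finset.sum_le_sum fun j hj => ?_
          split_ifs with h
          · subst h; simp [hAp i hi, hq]
          · simpa using hAq i hi j hj h
      _ = M * p + M ^ 2 * q := by
          simp [Finset.sum_add_distrib, hM]
          ring
  have hval : ∫ ω, (∑ i ∈ s, f i ω - M * p) ^ 2 ∂P ≤ M * p + M ^ 2 * q - (M * p) ^ 2 := by
    have : ∫ ω, (∑ i ∈ s, f i ω - M * p) ^ 2 ∂P =
        ∑ i ∈ s, ∑ j ∈ s, P.real (A i ∩ A j) - (M * p) ^ 2 := by
      simp_rw [hexp]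
      have hI12 : Integrable (fun ω => ∑ i ∈ s, ∑ j ∈ s, f i ω * f j ω
          - 2 * M * p * ∑ i ∈ s, f i ω) P := hI1.sub hI2
      have hE2 : ∫ ω, ∑ i ∈ s, ∑ j ∈ s, f i ω * f j ω ∂P =
          ∑ i ∈ s, ∑ j ∈ s, P.real (A i ∩ A j) := by
        rw [integral_finsetSum _ fun i _ => integrable_finsetSum _ fun j _ => hffi i j]
        refine Finset.sum_congr rfl fun i _ => ?_
        rw [integral_finsetSum _ fun j _ => hffi i j]
        exact Finset.sum_congr rfl fun j _ => hEff i j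
      rw [integral_add hI12 (integrable_const _), integral_sub hI1 hI2, hE2,
        integral_const_mul, integral_finsetSum _ fun i _ => hf i]
      simp_rw [hEf]
      rw [Finset.sum_congr rfl hAp]
      simp [← hM]
      ring
    rw [this]; linarith
  have hmarkov := mul_meas_ge_le_integral_of_nonneg (μ := P)
    (Filter.Eventually.of_forall fun ω => sq_nonneg (∑ i ∈ s, f i ω - M * p)) hint ((M * p) ^ 2)
  have hsub : P.real {ω | ∀ i ∈ s, ω ∉ A i} ≤
      P.real {ω | (M * p) ^ 2 ≤ (∑ i ∈ s, f i ω - M * p) ^ 2} := by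
    refine measureReal_mono fun ω hω => ?_
    have : ∑ i ∈ s, f i ω = 0 := Finset.sum_eq_zero fun i hi => by simp [f, hω i hi]
    simp [this]
  have hMp : 0 < (M * p) ^ 2 := by positivity
  have : P.real {ω | ∀ i ∈ s, ω ∉ A i} ≤ (M * p + M ^ 2 * q - (M * p) ^ 2) / (M * p) ^ 2 := by
    rw [le_div_iff₀ hMp]
    nlinarith
  refine this.trans_eq ?_
  field_simp
  ring

/-- Joint upper tail of two weakly correlated standard Gaussian variables. -/
lemma measureReal_lt_inter_lt_le {P : Measure Ω} {U V : Ω → ℝ}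
    (hUV : HasGaussianLaw (fun ω => (U ω, V ω)) P)
    (hU : P.map U = gaussianReal 0 1) (hV : P.map V = gaussianReal 0 1)
    {l r : ℝ} (hl : 0 ≤ l) (hr : |cov[U, V; P]| ≤ r) (hr4 : r ≤ 1 / 4) :
    P.real ({ω | l < U ω} ∩ {ω | l < V ω}) ≤
      Real.exp (4 * r * l ^ 2) * (gaussianReal 0 1).real (Set.Ioi l) ^ 2
        + 2 * Real.exp (-(13 / 8) * l ^ 2) := by
  have := hUV.isProbabilityMeasure
  have hUm := hUV.fst.aemeasurable
  have hVm := hUV.snd.aemeasurable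
  set c := cov[U, V; P] with hc
  have hU2 : MemLp U 2 P := hUV.fst.memLp_two
  have hV2 : MemLp V 2 P := hUV.snd.memLp_two
  have hvarU : Var[U; P] = 1 := by
    rw [← variance_id_map hUm, hU]; simp
  have hvarV : Var[V; P] = 1 := by
    rw [← variance_id_map hVm, hV]; simp
  have hEU : P[U] = 0 := by
    have := integral_map hUm (f := id) (by fun_prop)
    rw [hU] at this; simpa using this.symm
  have hEV : P[V] = 0 := by
    have := integral_map hVm (f := id) (by fun_prop)
    rw [hV] at this; simpa using this.symm
  let W : Ω → ℝ := fun ω => V ω - c * U ω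
  have hUW : HasGaussianLaw (fun ω => (U ω, W ω)) P :=
    hUV.map_fun ((ContinuousLinearMap.fst ℝ ℝ ℝ).prod
      (ContinuousLinearMap.snd ℝ ℝ ℝ - c • ContinuousLinearMap.fst ℝ ℝ ℝ))
  have hind : IndepFun U W P := by
    refine hUW.indepFun_of_covariance_eq_zero ?_
    have : cov[U, W; P] = cov[U, V; P] - cov[U, fun ω => c * U ω; P] :=
      covariance_sub_right hU2 hV2 (hU2.const_mul c)
    rw [this, covariance_const_mul_right, covariance_self hUm, hvarU]
    simp [hc]
  have hEW : P[W] = 0 := by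
    simp only [W]
    rw [integral_sub (hV2.integrable (by norm_num)) ((hU2.integrable (by norm_num)).const_mul c),
      integral_const_mul, hEU, hEV]
    simp
  have hvarW : Var[W; P] = 1 - c ^ 2 := by
    have : Var[W; P] = _ := variance_fun_sub hV2 (hU2.const_mul c)
    rw [this, variance_const_mul, hvarU, hvarV, covariance_const_mul_right, covariance_comm, ← hc]
    ring
  have hmapW : P.map W = gaussianReal 0 (1 - c ^ 2).toNNReal := by
    rw [hUW.snd.map_eq_gaussianReal, hEW, hvarW]
  set p := (gaussianReal 0 1).real (Set.Ioi l) with hp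
  have hr0 : 0 ≤ r := (abs_nonneg _).trans hr
  have hUtail (t : ℝ) : P.real {ω | t < U ω} = (gaussianReal 0 1).real (Set.Ioi t) := by
    rw [← hU, measureReal_def, measureReal_def,
      Measure.map_apply_of_aemeasurable hUm measurableSet_Ioi]
    rfl
  have hWtail : P.real {ω | l - 2 * r * l < W ω} ≤
      Real.exp (2 * l * (2 * r * l)) * p + Real.exp (-(9 / 8) * l ^ 2) := by
    have : P.real {ω | l - 2 * r * l < W ω} =
        (gaussianReal 0 (1 - c ^ 2).toNNReal).real (Set.Ioi (l - 2 * r * l)) := by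
      rw [← hmapW, measureReal_def, measureReal_def,
        Measure.map_apply_of_aemeasurable hUW.snd.aemeasurable measurableSet_Ioi]
      rfl
    rw [this]
    refine (gaussianReal_Ioi_le_of_le_one ?_ (by nlinarith)).trans
      (gaussianReal_Ioi_sub_le hl (by positivity) (by nlinarith))
    rw [Real.toNNReal_le_one]
    nlinarith [sq_nonneg c]
  have hsub : ({ω | l < U ω} ∩ {ω | l < V ω}) ⊆
      (U ⁻¹' Set.Ioi l ∩ W ⁻¹' Set.Ioi (l - 2 * r * l)) ∪ {ω | 2 * l < U ω} := by
    rintro ω ⟨h1, h2⟩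
    simp only [Set.mem_ofPred_eq] at h1 h2
    by_cases h : 2 * l < U ω
    · exact Or.inr h
    · refine Or.inl ⟨h1, ?_⟩
      simp only [Set.mem_preimage, Set.mem_Ioi, W]
      have h3 : c * U ω ≤ r * U ω :=
        mul_le_mul_of_nonneg_right ((le_abs_self c).trans hr) (hl.trans h1.le)
      nlinarith
  have hprod : P.real (U ⁻¹' Set.Ioi l ∩ W ⁻¹' Set.Ioi (l - 2 * r * l)) =
      p * P.real {ω | l - 2 * r * l < W ω} := by
    rw [measureReal_def, hind.measure_inter_preimage_eq_mul _ _ measurableSet_Ioi measurableSet_Ioi,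
      ENNReal.toReal_mul, hp, ← hUtail]
    rfl
  have htail2 : P.real {ω | 2 * l < U ω} ≤ Real.exp (-(13 / 8) * l ^ 2) := by
    rw [hUtail]
    refine (measureReal_mono Set.Ioi_subset_Ici_self).trans
      ((gaussianReal_Ici_le_exp (le_refl 1) (by positivity)).trans ?_)
    gcongr
    simp only [NNReal.coe_one]
    nlinarith [sq_nonneg l]
  have hpexp : p ≤ Real.exp (-l ^ 2 / 2) := by
    refine (measureReal_mono Set.Ioi_subset_Ici_self).trans
      ((gaussianReal_Ici_le_exp (le_refl 1) hl).trans_eq ?_)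
    simp
  have hp0 : 0 ≤ p := measureReal_nonneg
  calc P.real ({ω | l < U ω} ∩ {ω | l < V ω})
      ≤ p * P.real {ω | l - 2 * r * l < W ω} + P.real {ω | 2 * l < U ω} := by
        rw [← hprod]
        exact (measureReal_mono hsub).trans (measureReal_union_le _ _)
    _ ≤ p * (Real.exp (2 * l * (2 * r * l)) * p + Real.exp (-(9 / 8) * l ^ 2))
          + Real.exp (-(13 / 8) * l ^ 2) := by gcongr
    _ = Real.exp (4 * r * l ^ 2) * p ^ 2 + p * Real.exp (-(9 / 8) * l ^ 2)
          + Real.exp (-(13 / 8) * l ^ 2) := by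
        rw [show 2 * l * (2 * r * l) = 4 * r * l ^ 2 by ring]; ring
    _ ≤ Real.exp (4 * r * l ^ 2) * p ^ 2
          + Real.exp (-l ^ 2 / 2) * Real.exp (-(9 / 8) * l ^ 2)
          + Real.exp (-(13 / 8) * l ^ 2) := by gcongr
    _ = _ := by
        rw [← Real.exp_add, show -l ^ 2 / 2 + -(9 / 8) * l ^ 2 = -(13 / 8) * l ^ 2 by ring]
        ring

/-- Many weakly correlated standard Gaussian variables rarely all stay below a given level. -/
lemma measureReal_forall_le_le_of_covariance_le {ι : Type*} {P : Measure Ω}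
    [IsProbabilityMeasure P] {ξ : ι → Ω → ℝ} (hm : ∀ i, Measurable (ξ i))
    (hjoint : ∀ i j, HasGaussianLaw (fun ω => (ξ i ω, ξ j ω)) P)
    (hlaw : ∀ i, P.map (ξ i) = gaussianReal 0 1) {s : Finset ι} (hs : s.Nonempty)
    {l r : ℝ} (hl : 0 ≤ l) (hr4 : r ≤ 1 / 4)
    (hcov : ∀ i ∈ s, ∀ j ∈ s, i ≠ j → |cov[ξ i, ξ j; P]| ≤ r) :
    P.real {ω | ∀ i ∈ s, ξ i ω ≤ l} ≤
      √(2 * Real.pi) * Real.exp ((l + 1) ^ 2 / 2) / s.card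
        + (Real.exp (4 * r * l ^ 2) - 1)
        + 4 * Real.pi * Real.exp ((l + 1) ^ 2 - 13 / 8 * l ^ 2) := by
  set p := (gaussianReal 0 1).real (Set.Ioi l) with hp
  have hphi : gaussianPDFReal 0 1 (l + 1) = (√(2 * Real.pi) * Real.exp ((l + 1) ^ 2 / 2))⁻¹ := by
    simp [gaussianPDFReal, neg_div, Real.exp_neg]
    ring
  have hple : (√(2 * Real.pi) * Real.exp ((l + 1) ^ 2 / 2))⁻¹ ≤ p := by
    rw [← hphi]; exact gaussianPDFReal_add_one_le_gaussianReal_Ioi hl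
  have hE : 0 < √(2 * Real.pi) * Real.exp ((l + 1) ^ 2 / 2) := by positivity
  have hp0 : 0 < p := lt_of_lt_of_le (by positivity) hple
  have hpinv : 1 / p ≤ √(2 * Real.pi) * Real.exp ((l + 1) ^ 2 / 2) := by
    rw [one_div]; exact inv_le_of_inv_le₀ hE hple
  have hcard : (0 : ℝ) < s.card := by exact_mod_cast hs.card_pos
  have key := measureReal_iInter_compl_le P s (fun i => {ω | l < ξ i ω})
    (fun i => measurableSet_lt measurable_const (hm i)) hp0
    (q := Real.exp (4 * r * l ^ 2) * p ^ 2 + 2 * Real.exp (-(13 / 8) * l ^ 2)) (by positivity) hs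
    (fun i _ => by
      rw [hp, ← hlaw i, measureReal_def, measureReal_def,
        Measure.map_apply (hm i) measurableSet_Ioi]
      rfl)
    (fun i hi j hj hij => measureReal_lt_inter_lt_le (hjoint i j) (hlaw i) (hlaw j) hl
      (hcov i hi j hj hij) hr4)
  simp only [Set.mem_ofPred_eq, not_lt] at key
  refine key.trans ?_
  have h1 : 1 / (s.card * p) ≤ √(2 * Real.pi) * Real.exp ((l + 1) ^ 2 / 2) / s.card := by
    rw [mul_comm, ← div_div]
    gcongr
  have h2 : (Real.exp (4 * r * l ^ 2) * p ^ 2 + 2 * Real.exp (-(13 / 8) * l ^ 2)) / p ^ 2 =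
      Real.exp (4 * r * l ^ 2) + 2 * Real.exp (-(13 / 8) * l ^ 2) * (1 / p) ^ 2 := by
    field_simp
  have h3 : 2 * Real.exp (-(13 / 8) * l ^ 2) * (1 / p) ^ 2 ≤
      4 * Real.pi * Real.exp ((l + 1) ^ 2 - 13 / 8 * l ^ 2) := by
    calc 2 * Real.exp (-(13 / 8) * l ^ 2) * (1 / p) ^ 2
        ≤ 2 * Real.exp (-(13 / 8) * l ^ 2) *
            (√(2 * Real.pi) * Real.exp ((l + 1) ^ 2 / 2)) ^ 2 := by gcongr
      _ = _ := by
        rw [mul_pow, Real.sq_sqrt (by positivity), ← Real.exp_nat_mul,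
          show (l + 1) ^ 2 - 13 / 8 * l ^ 2 = -(13 / 8) * l ^ 2 + (2 : ℕ) * ((l + 1) ^ 2 / 2) by
            push_cast; ring, Real.exp_add]
        ring
  rw [h2]
  linarith

lemma tendsto_quadratic_atBot {c : ℝ} (hc : 0 < c) (k d : ℝ) :
    Tendsto (fun x : ℝ => -c * x ^ 2 + k * x + d) atTop atBot := by
  have h1 : Tendsto (fun x : ℝ => c * x - k) atTop atTop :=
    tendsto_atTop_add_const_right _ (-k) (tendsto_id.const_mul_atTop hc)
  have h2 : Tendsto (fun x : ℝ => -(x * (c * x - k))) atTop atBot :=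
    tendsto_neg_atTop_atBot.comp (tendsto_id.atTop_mul_atTop₀ h1)
  refine (tendsto_atBot_add_const_right _ d h2).congr fun x => ?_
  ring

/-- The bound of the second moment method vanishes as the level `x` tends to infinity, when the
logarithm of the number of variables is `γ x ^ 2` with `γ > 1 / 2`. -/
lemma tendsto_secondMoment_bound {γ κ : ℝ} (hγ : 1 / 2 < γ) (hκ : 0 < κ) (C : ℝ) :
    Tendsto (fun x : ℝ => √(2 * Real.pi) * Real.exp ((x + 1) ^ 2 / 2) / Real.exp (γ * x ^ 2)
      + (Real.exp (4 * (C * Real.exp (-(κ * x ^ 2))) * x ^ 2) - 1)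
      + 4 * Real.pi * Real.exp ((x + 1) ^ 2 - 13 / 8 * x ^ 2)) atTop (nhds 0) := by
  have h1 : Tendsto (fun x : ℝ => √(2 * Real.pi) * Real.exp ((x + 1) ^ 2 / 2)
      / Real.exp (γ * x ^ 2)) atTop (nhds 0) := by
    have := (Real.tendsto_exp_atBot.comp
      (tendsto_quadratic_atBot (sub_pos.2 hγ) 1 (1 / 2))).const_mul √(2 * Real.pi)
    rw [mul_zero] at this
    refine this.congr fun x => ?_
    rw [mul_div_assoc, ← Real.exp_sub, Function.comp_apply]
    congr 2
    ring
  have h2 : Tendsto (fun x : ℝ => Real.exp (4 * (C * Real.exp (-(κ * x ^ 2))) * x ^ 2) - 1)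
      atTop (nhds 0) := by
    have hy : Tendsto (fun x : ℝ => κ * x ^ 2) atTop atTop :=
      (tendsto_pow_atTop two_ne_zero).const_mul_atTop hκ
    have hz := ((Real.tendsto_pow_mul_exp_neg_atTop_nhds_zero 1).comp hy).const_mul (4 * C / κ)
    rw [mul_zero] at hz
    have := ((Real.continuous_exp.tendsto 0).comp hz).sub_const 1
    rw [Real.exp_zero, sub_self] at this
    refine this.congr fun x => ?_
    simp only [Function.comp_apply, pow_one]
    congr 2
    field_simp
  have h3 : Tendsto (fun x : ℝ => 4 * Real.pi * Real.exp ((x + 1) ^ 2 - 13 / 8 * x ^ 2))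
      atTop (nhds 0) := by
    have := (Real.tendsto_exp_atBot.comp
      (tendsto_quadratic_atBot (c := 5 / 8) (by norm_num) 2 1)).const_mul (4 * Real.pi)
    rw [mul_zero] at this
    refine this.congr fun x => ?_
    rw [Function.comp_apply]
    congr 2
    ring
  simpa using (h1.add h2).add h3

/-- A sequence of standard Gaussian variables whose correlations decay polynomially exceeds
`a √(2 log k)` infinitely often, for every `a < 1`. -/
lemma ae_frequently_lt_of_covariance_le_rpow {P : Measure Ω} [IsProbabilityMeasure P]
    {ξ : ℕ → Ω → ℝ} (hm : ∀ i, Measurable (ξ i))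
    (hjoint : ∀ i j, HasGaussianLaw (fun ω => (ξ i ω, ξ j ω)) P)
    (hlaw : ∀ i, P.map (ξ i) = gaussianReal 0 1) {C η : ℝ} {n₀ : ℕ} (hC : 0 ≤ C) (hη : 0 < η)
    (hcov : ∀ n ≥ n₀, ∀ i, |cov[ξ i, ξ (i + n); P]| ≤ C * (n : ℝ) ^ (-η))
    {a : ℝ} (ha0 : 0 < a) (ha1 : a < 1) :
    ∀ᵐ ω ∂P, ∃ᶠ k : ℕ in atTop, a * √(2 * Real.log k) < ξ k ω := by
  obtain ⟨q, hq⟩ : ∃ q : ℕ, a ^ 2 * (q + 1) < q := by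
    have ha2 : 0 < 1 - a ^ 2 := by nlinarith
    obtain ⟨q, hq⟩ := exists_nat_gt (a ^ 2 / (1 - a ^ 2))
    refine ⟨q, ?_⟩
    rw [div_lt_iff₀ ha2] at hq
    nlinarith
  set b : ℝ := a ^ 2 * (q + 1) with hb
  have hb0 : 0 < b := by positivity
  let x : ℕ → ℝ := fun m => √(2 * b * Real.log m)
  have hlog : Tendsto (fun m : ℕ => Real.log m) atTop atTop :=
    Real.tendsto_log_atTop.comp tendsto_natCast_atTop_atTop
  have hx : Tendsto x atTop atTop :=
    Real.tendsto_sqrt_atTop.comp (hlog.const_mul_atTop (by positivity))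
  have hγ : 1 / 2 < (q : ℝ) / (2 * b) := by
    rw [div_lt_div_iff₀ two_pos (by positivity)]; linarith
  have hκ : 0 < η / (2 * b) := by positivity
  have hB := (tendsto_secondMoment_bound hγ hκ C).comp hx
  have hrlim : ∀ᶠ m : ℕ in atTop, C * (m : ℝ) ^ (-η) ≤ 1 / 4 := by
    have := ((tendsto_rpow_neg_atTop hη).comp tendsto_natCast_atTop_atTop).const_mul C
    rw [mul_zero] at this
    exact (this.eventually (gt_mem_nhds (by norm_num : (0 : ℝ) < 1 / 4))).mono fun m hm => hm.le
  have hmain : ∀ᶠ m : ℕ in atTop,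
      P.real {ω | ∀ k ≥ m, ξ k ω ≤ a * √(2 * Real.log k)} ≤
        √(2 * Real.pi) * Real.exp ((x m + 1) ^ 2 / 2) / Real.exp (q / (2 * b) * x m ^ 2)
      + (Real.exp (4 * (C * Real.exp (-(η / (2 * b) * x m ^ 2))) * x m ^ 2) - 1)
      + 4 * Real.pi * Real.exp ((x m + 1) ^ 2 - 13 / 8 * x m ^ 2) := by
    filter_upwards [hrlim, eventually_ge_atTop n₀, eventually_ge_atTop 1] with m hr hn₀ hm1
    have hm0 : (0 : ℝ) < m := by exact_mod_cast hm1
    have hlog0 : 0 ≤ Real.log m := Real.log_nonneg (by exact_mod_cast hm1)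
    have hx2 : x m ^ 2 = 2 * b * Real.log m := Real.sq_sqrt (by positivity)
    have e1 : Real.exp (q / (2 * b) * x m ^ 2) = ((Finset.range (m ^ q)).card : ℝ) := by
      rw [hx2, Finset.card_range, Nat.cast_pow,
        show (q : ℝ) / (2 * b) * (2 * b * Real.log m) = q * Real.log m by field_simp,
        Real.exp_nat_mul, Real.exp_log hm0]
    have e2 : Real.exp (-(η / (2 * b) * x m ^ 2)) = (m : ℝ) ^ (-η) := by
      rw [hx2, Real.rpow_def_of_pos hm0]
      congr 1
      field_simp
    rw [e1, e2]
    have hdist (i d : ℕ) (hd : 1 ≤ d) :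
        |cov[ξ ((i + 1) * m), ξ ((i + d + 1) * m); P]| ≤ C * (m : ℝ) ^ (-η) := by
      have hmd : m ≤ d * m := Nat.le_mul_of_pos_left m hd
      have := hcov (d * m) (hn₀.trans hmd) ((i + 1) * m)
      rw [show (i + 1) * m + d * m = (i + d + 1) * m by ring] at this
      refine this.trans (mul_le_mul_of_nonneg_left ?_ hC)
      exact Real.rpow_le_rpow_of_nonpos hm0 (by exact_mod_cast hmd) (by linarith)
    refine le_trans ?_ (measureReal_forall_le_le_of_covariance_le (P := P)
      (ξ := fun j => ξ ((j + 1) * m)) (s := Finset.range (m ^ q)) (fun i => hm _)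
      (fun i j => hjoint _ _) (fun i => hlaw _)
      (Finset.nonempty_range_iff.2 (pow_pos hm1 q).ne') (l := x m) (Real.sqrt_nonneg _) hr ?_)
    · refine measureReal_mono fun ω hω j hj => ?_
      have hjm : (j + 1) * m ≤ m ^ (q + 1) := by
        rw [pow_succ]
        exact Nat.mul_le_mul_right m (Finset.mem_range.1 hj)
      have hj1 : m ≤ (j + 1) * m := Nat.le_mul_of_pos_left m (Nat.succ_pos j)
      refine (hω _ hj1).trans ?_
      have hxa : x m = a * √(2 * Real.log ((m : ℝ) ^ (q + 1))) := by
        simp only [x]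
        rw [Real.log_pow]
        nth_rewrite 1 [← Real.sqrt_sq ha0.le]
        rw [← Real.sqrt_mul (sq_nonneg a), hb]
        congr 1
        push_cast
        ring
      rw [hxa]
      have hpos : (0 : ℝ) < ((j + 1) * m : ℕ) := by exact_mod_cast hm1.trans hj1
      have : (((j + 1) * m : ℕ) : ℝ) ≤ (m : ℝ) ^ (q + 1) := by exact_mod_cast hjm
      gcongr
    · intro i _ j _ hij
      rcases lt_or_gt_of_ne hij with h | h
      · obtain ⟨d, rfl⟩ := Nat.exists_eq_add_of_le h.le
        exact hdist i d (by omega)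
      · obtain ⟨d, rfl⟩ := Nat.exists_eq_add_of_le h.le
        rw [covariance_comm]
        exact hdist j d (by omega)
  have hzero (N : ℕ) : P {ω | ∀ k ≥ N, ξ k ω ≤ a * √(2 * Real.log k)} = 0 := by
    have : P.real {ω | ∀ k ≥ N, ξ k ω ≤ a * √(2 * Real.log k)} ≤ 0 := by
      refine ge_of_tendsto hB ?_
      filter_upwards [hmain, eventually_ge_atTop N] with m hm hN
      refine le_trans (measureReal_mono ?_) hm
      exact fun ω hω k hk => hω k (hN.trans hk)
    exact (measureReal_eq_zero_iff).1 (le_antisymm this measureReal_nonneg)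
  have hall : ∀ᵐ ω ∂P, ∀ N : ℕ, ¬ ∀ k ≥ N, ξ k ω ≤ a * √(2 * Real.log k) :=
    ae_all_iff.2 fun N => by
      rw [ae_iff]
      simpa using hzero N
  filter_upwards [hall] with ω hω
  rw [frequently_atTop]
  intro N
  have := hω N
  push Not at this
  exact this

lemma StrongDual.exists_forall_apply_eq_sum {ι : Type*} [Fintype ι] (L : StrongDual ℝ (ι → ℝ)) :
    ∃ b : ι → ℝ, ∀ x, L x = ∑ i, b i * x i := by
  classical
  refine ⟨fun i => L fun j => if i = j then 1 else 0, fun x => ?_⟩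
  rw [← ContinuousLinearMap.coe_coe, LinearMap.pi_apply_eq_sum_univ]
  simp [mul_comm]

/-- Two centered Gaussian vectors with the same covariances have the same law. -/
lemma map_eq_map_of_forall_covariance_eq {P : Measure Ω} [IsProbabilityMeasure P]
    {ι : Type*} [Fintype ι] {Y Z : ι → Ω → ℝ}
    (hY : HasGaussianLaw (fun ω i => Y i ω) P) (hZ : HasGaussianLaw (fun ω i => Z i ω) P)
    (hY0 : ∀ i, P[Y i] = 0) (hZ0 : ∀ i, P[Z i] = 0)
    (hcov : ∀ i j, cov[Y i, Y j; P] = cov[Z i, Z j; P]) :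
    P.map (fun ω i => Y i ω) = P.map (fun ω i => Z i ω) := by
  have := Measure.isProbabilityMeasure_map hY.aemeasurable
  have := Measure.isProbabilityMeasure_map hZ.aemeasurable
  refine Measure.ext_of_charFunDual (funext fun L => ?_)
  obtain ⟨b, hL⟩ := StrongDual.exists_forall_apply_eq_sum L
  have hYL (i : ι) : MemLp (fun ω => b i * Y i ω) 2 P :=
    (hY.eval i).memLp_two.const_mul _
  have hZL (i : ι) : MemLp (fun ω => b i * Z i ω) 2 P :=
    (hZ.eval i).memLp_two.const_mul _
  rw [hY.charFunDual_map_eq_fun, hZ.charFunDual_map_eq_fun]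
  simp_rw [hL]
  have hmean : ∫ ω, ∑ i, b i * Y i ω ∂P =
      ∫ ω, ∑ i, b i * Z i ω ∂P := by
    rw [integral_finsetSum _ fun i _ => (hYL i).integrable one_le_two,
      integral_finsetSum _ fun i _ => (hZL i).integrable one_le_two]
    simp [integral_const_mul, hY0, hZ0]
  have hvar : Var[fun ω => ∑ i, b i * Y i ω; P] =
      Var[fun ω => ∑ i, b i * Z i ω; P] := by
    rw [← covariance_self (Finset.aemeasurable_fun_sum _ fun i _ => (hYL i).1.aemeasurable),
      ← covariance_self (Finset.aemeasurable_fun_sum _ fun i _ => (hZL i).1.aemeasurable),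
      covariance_fun_sum_fun_sum hYL hYL, covariance_fun_sum_fun_sum hZL hZL]
    simp_rw [covariance_const_mul_left, covariance_const_mul_right, hcov]
  rw [hmean, hvar]

namespace IsCenteredGaussianProcess

variable {P : Measure Ω} {X : ℝ → Ω → ℝ}

lemma hasGaussianLaw (h : IsCenteredGaussianProcess P X) {k : ℕ} {t : Fin k → ℝ}
    (ht : ∀ i, 0 ≤ t i) : HasGaussianLaw (fun ω i => X (t i) ω) P where
  isGaussian_map := by
    refine isGaussian_of_map_eq_gaussianReal fun L => ?_
    obtain ⟨b, hL⟩ := StrongDual.exists_forall_apply_eq_sum L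
    obtain ⟨v, hv⟩ := h.2 k t b ht
    refine ⟨0, v, ?_⟩
    rw [← hv, Measure.map_map L.continuous.measurable (measurable_pi_lambda _ fun i => h.1 _)]
    congr 1
    ext ω
    exact hL _

lemma hasGaussianLaw_prodMk (h : IsCenteredGaussianProcess P X) {s t : ℝ} (hs : 0 ≤ s)
    (ht : 0 ≤ t) : HasGaussianLaw (fun ω => (X s ω, X t ω)) P := by
  have := (h.hasGaussianLaw (k := 2) (t := ![s, t])
    (Fin.forall_fin_two.2 ⟨hs, ht⟩)).prodMk (X := fun i => X (![s, t] i)) 0 1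
  simpa using this

lemma integral_eq_zero (h : IsCenteredGaussianProcess P X) {s : ℝ} (hs : 0 ≤ s) :
    P[X s] = 0 := by
  obtain ⟨v, hv⟩ := h.2 1 (fun _ => s) (fun _ => 1) fun _ => hs
  simp only [Finset.univ_unique, Finset.sum_const, Finset.card_singleton, one_smul, one_mul] at hv
  have := integral_map (h.1 s).aemeasurable (μ := P) (f := id) (by fun_prop)
  rw [show (fun ω => X s ω) = X s from rfl] at hv
  rw [hv] at this
  simpa using this.symm

lemma covariance_eq [IsProbabilityMeasure P] (h : IsCenteredGaussianProcess P X) {s t : ℝ}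
    (hs : 0 ≤ s) (ht : 0 ≤ t) : cov[X s, X t; P] = ∫ ω, X s ω * X t ω ∂P := by
  have := h.hasGaussianLaw_prodMk hs ht
  rw [covariance_eq_sub this.fst.memLp_two this.snd.memLp_two, h.integral_eq_zero hs]
  simp

lemma map_eq_gaussianReal [IsProbabilityMeasure P] (h : IsCenteredGaussianProcess P X) {s : ℝ}
    (hs : 0 ≤ s) : P.map (X s) = gaussianReal 0 (∫ ω, X s ω * X s ω ∂P).toNNReal := by
  rw [(h.hasGaussianLaw_prodMk hs hs).fst.map_eq_gaussianReal, h.integral_eq_zero hs,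
    ← covariance_self (h.1 s).aemeasurable, h.covariance_eq hs hs]

lemma neg (h : IsCenteredGaussianProcess P X) :
    IsCenteredGaussianProcess P fun s ω => -X s ω := by
  refine ⟨fun s => (h.1 s).neg, fun k t c ht => ?_⟩
  obtain ⟨v, hv⟩ := h.2 k t (fun i => -c i) ht
  exact ⟨v, by simpa using hv⟩

/-- A centered Gaussian process with self-similar covariance has self-similar finite-dimensional
laws. -/
lemma map_selfSimilar_eq [IsProbabilityMeasure P] (h : IsCenteredGaussianProcess P X) {c ρ : ℝ}
    (hc : 0 < c)
    (hss : ∀ s > 0, ∀ t > 0,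
      ∫ ω, X (c * s) ω * X (c * t) ω ∂P = c ^ (2 * ρ) * ∫ ω, X s ω * X t ω ∂P)
    {k : ℕ} {t : Fin k → ℝ} (ht : ∀ i, 0 < t i) :
    P.map (fun ω i => X (c * t i) ω) = P.map (fun ω i => c ^ ρ * X (t i) ω) := by
  have hct (i : Fin k) : 0 ≤ c * t i := (mul_pos hc (ht i)).le
  refine map_eq_map_of_forall_covariance_eq (Y := fun i => X (c * t i))
    (Z := fun i ω => c ^ ρ * X (t i) ω) (h.hasGaussianLaw hct) ?_
    (fun i => h.integral_eq_zero (hct i)) (fun i => ?_) fun i j => ?_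
  · exact (h.hasGaussianLaw fun i => (ht i).le).fun_smul (c ^ ρ)
  · rw [integral_const_mul, h.integral_eq_zero (ht i).le, mul_zero]
  · rw [covariance_const_mul_left, covariance_const_mul_right, h.covariance_eq (hct i) (hct j),
      h.covariance_eq (ht i).le (ht j).le, hss _ (ht i) _ (ht j), two_mul, Real.rpow_add hc,
      mul_assoc]

end IsCenteredGaussianProcess

/-- **Fernique's theorem** with constants that do not depend on the dimension. -/
lemma exists_measureReal_lt_norm_le_exp :
    ∃ K κ : ℝ, 0 < K ∧ 0 < κ ∧ ∀ (n : ℕ) (μ : Measure (Fin n → ℝ)) [IsGaussian μ],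
      (∀ L : StrongDual ℝ (Fin n → ℝ), μ[L] = 0) → ∀ a > 0, 3 / 4 ≤ μ.real {x | ‖x‖ ≤ a} →
        ∀ t ≥ 0, μ.real {x | t < ‖x‖} ≤ K * Real.exp (-(κ * (t / a) ^ 2)) := by
  let c : ENNReal := ENNReal.ofReal (3 / 4)
  have hc_gt : 2⁻¹ < c := by
    rw [← ENNReal.ofReal_ofNat, ← ENNReal.ofReal_inv_of_pos two_pos]
    exact (ENNReal.ofReal_lt_ofReal_iff (by norm_num)).2 (by norm_num)
  have hc_lt : c < 1 := by
    rw [← ENNReal.ofReal_one]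
    exact (ENNReal.ofReal_lt_ofReal_iff (by norm_num)).2 (by norm_num)
  have hc_sub : (c / (1 - c)).toReal = 3 := by
    rw [← ENNReal.ofReal_one, ← ENNReal.ofReal_sub _ (by norm_num),
      ← ENNReal.ofReal_div_of_pos (by norm_num), ENNReal.toReal_ofReal (by norm_num)]
    norm_num
  let B : ENNReal := ENNReal.ofReal (Real.exp (Fernique.logRatio c)) +
    ∑' n : ℕ, ENNReal.ofReal (Real.exp (-2⁻¹ * Real.log (c / (1 - c)).toReal * 2 ^ n))
  have hB : B ≠ ⊤ := by
    refine (ENNReal.add_lt_top.mpr ⟨ENNReal.ofReal_lt_top, ?_⟩).ne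
    refine Summable.tsum_ofReal_lt_top <|
      Real.summable_exp_nat_mul_of_ge ?_ (fun i ↦ mod_cast (Nat.lt_pow_self (by simp)).le)
    rw [hc_sub]
    exact mul_neg_of_neg_of_pos (by norm_num) (Real.log_pos (by norm_num))
  have hB0 : 0 < B.toReal := by
    refine ENNReal.toReal_pos (ne_of_gt ?_) hB
    exact (ENNReal.ofReal_pos.2 (Real.exp_pos _)).trans_le le_self_add
  refine ⟨B.toReal, Fernique.logRatio c, hB0, Fernique.logRatio_pos hc_gt hc_lt, ?_⟩
  intro n μ _ hμ a ha hμa t ht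
  have hca : c ≤ μ {x | ‖x‖ ≤ a} := by
    rw [← ofReal_measureReal]
    exact ENNReal.ofReal_le_ofReal hμa
  have hint : ∫⁻ x, ENNReal.ofReal (Real.exp (Fernique.logRatio c * a⁻¹ ^ 2 * ‖x‖ ^ 2)) ∂μ ≤ B :=
    lintegral_exp_mul_sq_norm_le_of_map_rotation_eq_self
      (IsGaussian.map_rotation_eq_self_of_forall_strongDual_eq_zero hμ _) hca hc_gt
  set e : ℝ := Real.exp (Fernique.logRatio c * (t / a) ^ 2) with he
  have hmarkov : ENNReal.ofReal e * μ {x | t < ‖x‖} ≤ B := by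
    refine le_trans ?_ hint
    refine le_trans ?_ (mul_meas_ge_le_lintegral (by fun_prop) (ENNReal.ofReal e))
    gcongr
    intro hx
    have := Fernique.logRatio_nonneg hc_gt.le hc_lt.le
    rw [he, show Fernique.logRatio c * (t / a) ^ 2 = Fernique.logRatio c * a⁻¹ ^ 2 * t ^ 2 by
      field_simp]
    gcongr
  have h2 := ENNReal.toReal_mono hB hmarkov
  rw [ENNReal.toReal_mul, ENNReal.toReal_ofReal (Real.exp_pos _).le] at h2
  rw [Real.exp_neg, ← div_eq_mul_inv, le_div_iff₀ (Real.exp_pos _), mul_comm]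
  exact h2

lemma ae_eventually_not_of_measureReal_le {P : Measure Ω} [IsFiniteMeasure P]
    {p : ℕ → Ω → Prop} {f : ℕ → ℝ}
    (hf : Summable f) (h : ∀ᶠ k in atTop, P.real {ω | p k ω} ≤ f k) :
    ∀ᵐ ω ∂P, ∀ᶠ k in atTop, ¬ p k ω := by
  refine ae_eventually_notMem (s := fun k => {ω | p k ω}) ?_
  have : Summable fun k => P.real {ω | p k ω} :=
    Summable.of_norm_bounded_eventually_nat hf (h.mono fun k hk => by
      rwa [Real.norm_of_nonneg measureReal_nonneg])
  simpa using this.tsum_ofReal_ne_top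

lemma summable_div_rpow_neg {L : ℝ} (hL : 0 ≤ L) {p : ℝ} (hp : 1 < p) :
    Summable fun k : ℕ => ((k : ℝ) / L) ^ (-p) := by
  simp_rw [Real.div_rpow (Nat.cast_nonneg _) hL]
  exact (Real.summable_nat_rpow.2 (by linarith)).div_const _

namespace IsCenteredGaussianProcess

variable {P : Measure Ω} [IsProbabilityMeasure P] {X : ℝ → Ω → ℝ} {ρ : ℝ}

/-- Fernique's bound for the increments of a self-similar process from a given time, uniform in
that time. -/
lemma exists_measureReal_exists_lt_abs_sub_le_exp (h : IsCenteredGaussianProcess P X)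
    (hss : ∀ c > 0, ∀ s > 0, ∀ t > 0,
      ∫ ω, X (c * s) ω * X (c * t) ω ∂P = c ^ (2 * ρ) * ∫ ω, X s ω * X t ω ∂P) :
    ∃ K κ : ℝ, 0 < K ∧ 0 < κ ∧ ∀ (w : ℕ → ℝ), (∀ i, 0 < w i) → ∀ a > 0,
      3 / 4 ≤ P.real {ω | ∀ i, |X (w i) ω - X 1 ω| ≤ a} → ∀ t ≥ 0, ∀ c > 0,
        P.real {ω | ∃ i, c ^ ρ * t < |X (c * w i) ω - X c ω|} ≤
          K * Real.exp (-(κ * (t / a) ^ 2)) := by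
  obtain ⟨K, κ, hK, hκ, hF⟩ := exists_measureReal_lt_norm_le_exp
  refine ⟨K, κ, hK, hκ, fun w hw a ha hwa t ht c hc => ?_⟩
  have hcρ : 0 < c ^ ρ := Real.rpow_pos_of_pos hc ρ
  have hfin (n : ℕ) : P.real {ω | ∃ i : Fin n, c ^ ρ * t < |X (c * w i) ω - X c ω|} ≤
      K * Real.exp (-(κ * (t / a) ^ 2)) := by
    let τ : Fin (n + 1) → ℝ := Fin.cons 1 fun i => w i
    have hτ (i : Fin (n + 1)) : 0 < τ i := by
      refine Fin.cases ?_ (fun i => ?_) i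
      · simp [τ]
      · simpa [τ] using hw i
    let D : (Fin (n + 1) → ℝ) →L[ℝ] (Fin n → ℝ) := ContinuousLinearMap.pi fun i =>
      ContinuousLinearMap.proj (R := ℝ) (φ := fun _ => ℝ) i.succ - ContinuousLinearMap.proj 0
    have hZ := (h.hasGaussianLaw fun i => (hτ i).le).map_fun D
    have hDX (ω : Ω) (i : Fin n) : D (fun j => X (τ j) ω) i = X (w i) ω - X 1 ω := by simp [D, τ]
    have hG := hZ.isGaussian_map
    have hmeas : Measurable fun ω => D fun j => X (τ j) ω :=
      D.continuous.measurable.comp (measurable_pi_lambda _ fun j => h.1 _)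
    have hmean (L : StrongDual ℝ (Fin n → ℝ)) :
        (P.map fun ω => D fun j => X (τ j) ω)[L] = 0 := by
      obtain ⟨b, hb⟩ := StrongDual.exists_forall_apply_eq_sum L
      rw [integral_map hmeas.aemeasurable (by fun_prop)]
      simp_rw [hb, hDX]
      have hint (s : ℝ) (hs : 0 ≤ s) : Integrable (X s) P :=
        (h.hasGaussianLaw_prodMk hs hs).fst.integrable
      have hint' (i : Fin n) : Integrable (fun ω => b i * (X (w i) ω - X 1 ω)) P :=
        ((hint _ (hw i).le).sub (hint 1 zero_le_one)).const_mul (b i)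
      rw [integral_finsetSum _ fun i _ => hint' i]
      refine Finset.sum_eq_zero fun i _ => ?_
      rw [integral_const_mul, integral_sub (hint _ (hw i).le) (hint 1 zero_le_one),
        h.integral_eq_zero (hw i).le, h.integral_eq_zero zero_le_one, sub_zero, mul_zero]
    have hbound := hF n _ hmean a ha ?_ t ht
    · refine le_trans (le_of_eq ?_) hbound
      have hlaw := h.map_selfSimilar_eq hc (hss c hc) hτ
      have hS : MeasurableSet {x : Fin (n + 1) → ℝ | c ^ ρ * t < ‖D x‖} :=
        measurableSet_lt measurable_const D.continuous.norm.measurable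
      have hS' : MeasurableSet {x : Fin n → ℝ | t < ‖x‖} :=
        measurableSet_lt measurable_const measurable_norm
      have key := congr_arg (fun μ => μ.real {x | c ^ ρ * t < ‖D x‖}) hlaw
      rw [map_measureReal_apply (measurable_pi_lambda _ fun i => h.1 _) hS,
        map_measureReal_apply (measurable_pi_lambda _ fun i => (h.1 _).const_mul _) hS] at key
      rw [map_measureReal_apply hmeas hS']
      convert key using 2
      · ext ω
        have : c ^ ρ * t < ‖D fun i => X (c * τ i) ω‖ ↔
            ∃ i : Fin n, c ^ ρ * t < |X (c * w i) ω - X c ω| := by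
          rw [← not_le, pi_norm_le_iff_of_nonneg (by positivity)]
          simp [D, τ]
        exact this.symm
      · ext ω
        have : (D fun i => c ^ ρ * X (τ i) ω) = c ^ ρ • D fun i => X (τ i) ω := by
          rw [← map_smul]; rfl
        simp only [Set.mem_preimage, Set.mem_ofPred_eq, this, norm_smul, Real.norm_eq_abs,
          abs_of_pos hcρ]
        exact (mul_lt_mul_iff_right₀ hcρ).symm
    · rw [map_measureReal_apply hmeas (measurableSet_le measurable_norm measurable_const)]
      refine hwa.trans (measureReal_mono fun ω hω => ?_)
      refine (pi_norm_le_iff_of_nonneg ha.le).2 fun i => ?_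
      exact (congrArg norm (hDX ω i)).trans_le (hω i)
  have hU : {ω | ∃ i, c ^ ρ * t < |X (c * w i) ω - X c ω|} =
      ⋃ n : ℕ, {ω | ∃ i : Fin n, c ^ ρ * t < |X (c * w i) ω - X c ω|} := by
    ext ω
    simp only [Set.mem_ofPred_eq, Set.mem_iUnion]
    exact ⟨fun ⟨i, hi⟩ => ⟨i + 1, ⟨i, i.lt_succ_self⟩, hi⟩, fun ⟨_, i, hi⟩ => ⟨i, hi⟩⟩
  have hmono : Monotone fun n : ℕ => {ω | ∃ i : Fin n, c ^ ρ * t < |X (c * w i) ω - X c ω|} :=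
    fun m n hmn ω ⟨i, hi⟩ => ⟨Fin.castLE hmn i, hi⟩
  rw [measureReal_def, hU, hmono.measure_iUnion]
  refine ENNReal.toReal_le_of_le_ofReal (by positivity) (iSup_le fun n => ?_)
  rw [← ofReal_measureReal]
  exact ENNReal.ofReal_le_ofReal (hfin n)

/-- With large probability the increments from time `1` are small on a short interval. The
interval `[1, θ]` is explored through a dense sequence. -/
lemma exists_measureReal_forall_abs_sub_le (h : IsCenteredGaussianProcess P X)
    (hcont : ∀ᵐ ω ∂P, ContinuousOn (fun s : ℝ => X s ω) (Set.Ici 0)) {a : ℝ} (ha : 0 < a) :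
    ∃ L : ℕ, 0 < L ∧ 3 / 4 ≤ P.real {ω | ∀ i : ℕ, |X (max 1 (min (Real.exp (1 / L))
      (TopologicalSpace.denseSeq ℝ i))) ω - X 1 ω| ≤ a} := by
  let A : ℕ → Set Ω := fun L => {ω | ∀ i : ℕ, |X (max 1 (min (Real.exp (1 / L))
    (TopologicalSpace.denseSeq ℝ i))) ω - X 1 ω| ≤ a}
  have hA (L : ℕ) : MeasurableSet (A L) := by
    simp only [A, Set.ofPred_forall]
    exact MeasurableSet.iInter fun i =>
      measurableSet_le (continuous_abs.measurable.comp ((h.1 _).sub (h.1 _))) measurable_const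
  have hev : ∀ᵐ ω ∂P, ∀ᶠ L in atTop, ω ∈ A L ↔ ω ∈ Set.univ := by
    filter_upwards [hcont] with ω hω
    have hat : ContinuousAt (fun s => X s ω) 1 := hω.continuousAt (Ici_mem_nhds one_pos)
    obtain ⟨δ, hδ, hδa⟩ := Metric.continuousAt_iff.1 hat a ha
    have hlim : Tendsto (fun L : ℕ => Real.exp (1 / (L : ℝ))) atTop (nhds 1) := by
      have := (Real.continuous_exp.tendsto 0).comp (tendsto_one_div_atTop_nhds_zero_nat (𝕜 := ℝ))
      rwa [Real.exp_zero] at this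
    filter_upwards [hlim.eventually (gt_mem_nhds (lt_add_of_pos_right 1 hδ))] with L hL
    simp only [Set.mem_univ, iff_true]
    intro i
    refine (hδa ?_).le
    rw [Real.dist_eq, abs_lt]
    have h1 := le_max_left 1 (min (Real.exp (1 / L)) (TopologicalSpace.denseSeq ℝ i))
    have h2 : max 1 (min (Real.exp (1 / L)) (TopologicalSpace.denseSeq ℝ i)) < 1 + δ :=
      max_lt (by linarith) ((min_le_left _ _).trans_lt hL)
    constructor <;> linarith
  have hlim := tendsto_measure_of_ae_tendsto_indicator_of_isFiniteMeasure atTop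
    MeasurableSet.univ hA hev
  have hlim' : Tendsto (fun L => P.real (A L)) atTop (nhds 1) := by
    have := (ENNReal.tendsto_toReal (measure_ne_top P Set.univ)).comp hlim
    simpa using! this
  obtain ⟨L, hL0, hL⟩ := ((eventually_gt_atTop 0).and
    (hlim'.eventually (lt_mem_nhds (by norm_num : (3 / 4 : ℝ) < 1)))).exists
  exact ⟨L, hL0, hL.le⟩

/-- The upper half of the law of the iterated logarithm. -/
lemma ae_eventually_div_le (h : IsCenteredGaussianProcess P X) (hρ : 0 < ρ)
    (hcont : ∀ᵐ ω ∂P, ContinuousOn (fun s : ℝ => X s ω) (Set.Ici 0))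
    (hss : ∀ c > 0, ∀ s > 0, ∀ t > 0,
      ∫ ω, X (c * s) ω * X (c * t) ω ∂P = c ^ (2 * ρ) * ∫ ω, X s ω * X t ω ∂P)
    {σ : ℝ} (hσ : 0 ≤ σ) (hvar : ∫ ω, X 1 ω * X 1 ω ∂P = σ ^ 2) {ε : ℝ} (hε : 0 < ε) :
    ∀ᵐ ω ∂P, ∀ᶠ s : ℝ in atTop,
      X s ω / √(2 * s ^ (2 * ρ) * Real.log (Real.log s)) ≤ σ + 2 * ε := by
  obtain ⟨K, κ, hK, hκ, hF⟩ := h.exists_measureReal_exists_lt_abs_sub_le_exp hss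
  obtain ⟨L, hL, hLa⟩ := h.exists_measureReal_forall_abs_sub_le hcont
    (a := ε * √κ) (by positivity)
  have hL' : (0 : ℝ) < L := by exact_mod_cast hL
  set w : ℕ → ℝ := fun i => max 1 (min (Real.exp (1 / L)) (TopologicalSpace.denseSeq ℝ i))
  let c : ℕ → ℝ := fun k => Real.exp (k / L)
  let l : ℕ → ℝ := fun k => √(2 * Real.log (k / L))
  have hc (k : ℕ) : 0 < c k := Real.exp_pos _
  have hl2 : ∀ᶠ k : ℕ in atTop, 0 < (k : ℝ) / L ∧ l k ^ 2 = 2 * Real.log (k / L) := by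
    filter_upwards [eventually_ge_atTop L] with k hk
    have : 1 ≤ (k : ℝ) / L := (one_le_div hL').2 (by exact_mod_cast hk)
    exact ⟨by linarith, Real.sq_sqrt (by have := Real.log_nonneg this; positivity)⟩
  have hpoint : ∀ᵐ ω ∂P, ∀ᶠ k in atTop, ¬ (σ + ε) * (c k ^ ρ * l k) ≤ X (c k) ω := by
    have hp : 1 < ((σ + ε) / (σ + ε / 2)) ^ 2 :=
      one_lt_pow₀ ((one_lt_div (by positivity)).2 (by linarith)) two_ne_zero
    refine ae_eventually_not_of_measureReal_le (summable_div_rpow_neg hL'.le hp) ?_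
    filter_upwards [hl2] with k ⟨hk0, hk⟩
    have hck : 0 < c k ^ ρ := Real.rpow_pos_of_pos (hc k) ρ
    have hv := hss (c k) (hc k) 1 one_pos 1 one_pos
    simp only [mul_one] at hv
    rw [hvar, two_mul, Real.rpow_add (hc k)] at hv
    have hle : (∫ ω, X (c k) ω * X (c k) ω ∂P).toNNReal ≤
        ((c k ^ ρ * (σ + ε / 2)) ^ 2).toNNReal := by
      refine Real.toNNReal_le_toNNReal ?_
      rw [hv, mul_pow, ← sq]
      gcongr
      linarith
    have := gaussianReal_Ici_le_exp hle (t := (σ + ε) * (c k ^ ρ * l k)) (by positivity)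
    rw [← h.map_eq_gaussianReal (hc k).le, map_measureReal_apply (h.1 _) measurableSet_Ici] at this
    refine this.trans_eq ?_
    rw [Real.coe_toNNReal _ (sq_nonneg _), Real.rpow_def_of_pos hk0]
    congr 1
    rw [mul_pow, mul_pow, hk]
    field_simp
  have hosc : ∀ᵐ ω ∂P, ∀ᶠ k in atTop,
      ¬ ∃ i, c k ^ ρ * (ε * l k) < |X (c k * w i) ω - X (c k) ω| := by
    refine ae_eventually_not_of_measureReal_le
      ((summable_div_rpow_neg hL'.le one_lt_two).mul_left K) ?_
    filter_upwards [hl2] with k ⟨hk0, hk⟩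
    refine (hF w (fun i => one_pos.trans_le (le_max_left _ _)) _ (by positivity) hLa (ε * l k)
      (by positivity) (c k) (hc k)).trans_eq ?_
    rw [Real.rpow_def_of_pos hk0, div_pow, mul_pow, mul_pow, hk, Real.sq_sqrt hκ.le]
    congr 2
    field_simp
  filter_upwards [hcont, hpoint, hosc] with ω hω h1 h2
  have hfloor : Tendsto (fun s : ℝ => ⌊L * Real.log s⌋₊) atTop atTop :=
    tendsto_nat_floor_atTop.comp (Real.tendsto_log_atTop.const_mul_atTop hL')
  filter_upwards [hfloor.eventually h1, hfloor.eventually h2,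
    hfloor.eventually (eventually_ge_atTop L), eventually_gt_atTop 1] with s hs1 hs2 hk hs
  set k := ⌊L * Real.log s⌋₊
  have hlog : 0 < Real.log s := Real.log_pos hs
  have hk1 : (k : ℝ) / L ≤ Real.log s := by
    rw [div_le_iff₀' hL']
    exact Nat.floor_le (by positivity)
  have hk2 : Real.log s ≤ k / L + 1 / L := by
    rw [← add_div, le_div_iff₀' hL']
    exact (Nat.lt_floor_add_one _).le
  have hcs : c k ≤ s := by
    rw [← Real.exp_log (one_pos.trans hs)]
    exact Real.exp_le_exp.2 hk1
  have hsc : s / c k ≤ Real.exp (1 / L) := by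
    rw [div_le_iff₀ (hc k), mul_comm, ← Real.exp_add, ← Real.log_le_iff_le_exp (one_pos.trans hs)]
    exact hk2
  have hinc : |X (c k * max 1 (min (Real.exp (1 / L)) (s / c k))) ω - X (c k) ω| ≤
      c k ^ ρ * (ε * l k) := by
    have hcont' : Continuous fun u =>
        |X (c k * max 1 (min (Real.exp (1 / L)) u)) ω - X (c k) ω| := by
      refine ((hω.comp_continuous (by fun_prop) fun u => ?_).sub continuous_const).abs
      exact (mul_pos (hc k) (one_pos.trans_le (le_max_left _ _))).le
    refine (TopologicalSpace.denseRange_denseSeq ℝ).induction_on (s / c k)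
      (isClosed_le hcont' continuous_const) fun i => ?_
    push Not at hs2
    exact hs2 i
  rw [min_eq_right hsc, max_eq_right ((one_le_div (hc k)).2 hcs),
    mul_div_cancel₀ _ (hc k).ne'] at hinc
  have hX : X s ω ≤ (σ + 2 * ε) * (c k ^ ρ * l k) := by
    have := (abs_le.1 hinc).2
    linarith [not_le.1 hs1]
  refine div_le_of_le_mul₀ (Real.sqrt_nonneg _) (by positivity) (hX.trans ?_)
  gcongr
  have hkL : 1 ≤ (k : ℝ) / L := (one_le_div hL').2 (by exact_mod_cast hk)
  rw [← Real.sqrt_sq (Real.rpow_nonneg (hc k).le ρ), ← Real.sqrt_mul (sq_nonneg _), sq,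
    ← Real.rpow_add (hc k), ← two_mul]
  refine Real.sqrt_le_sqrt ?_
  have := Real.log_nonneg hkL
  calc c k ^ (2 * ρ) * (2 * Real.log (k / L))
      ≤ s ^ (2 * ρ) * (2 * Real.log (Real.log s)) := by gcongr
    _ = 2 * s ^ (2 * ρ) * Real.log (Real.log s) := by ring

/-- The lower half of the law of the iterated logarithm. -/
lemma ae_frequently_le_div (h : IsCenteredGaussianProcess P X)
    (hss : ∀ c > 0, ∀ s > 0, ∀ t > 0,
      ∫ ω, X (c * s) ω * X (c * t) ω ∂P = c ^ (2 * ρ) * ∫ ω, X s ω * X t ω ∂P)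
    {η : ℝ} (hη : 0 < η)
    (hdecay : (fun x : ℝ => x ^ (-ρ) * ∫ ω, X 1 ω * X x ω ∂P) =O[atTop]
      fun x : ℝ => Real.log x ^ (-η))
    {σ : ℝ} (hσ : 0 ≤ σ) (hvar : ∫ ω, X 1 ω * X 1 ω ∂P = σ ^ 2) {ε : ℝ} (hε : 0 < ε) :
    ∀ᵐ ω ∂P, ∃ᶠ s : ℝ in atTop,
      σ - ε ≤ X s ω / √(2 * s ^ (2 * ρ) * Real.log (Real.log s)) := by
  have hexp : Tendsto (fun k : ℕ => Real.exp k) atTop atTop :=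
    Real.tendsto_exp_atTop.comp tendsto_natCast_atTop_atTop
  have hdiag (k : ℕ) : ∫ ω, X (Real.exp k) ω * X (Real.exp k) ω ∂P =
      (Real.exp k ^ ρ * σ) ^ 2 := by
    have := hss (Real.exp k) (Real.exp_pos _) 1 one_pos 1 one_pos
    simp only [mul_one] at this
    rw [this, hvar, mul_comm 2 ρ, Real.rpow_mul (Real.exp_pos _).le, Real.rpow_two, mul_pow]
  rcases hσ.eq_or_lt with rfl | hσ
  · have hzero : ∀ᵐ ω ∂P, ∀ k : ℕ, X (Real.exp k) ω = 0 := by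
      refine ae_all_iff.2 fun k => ?_
      have hmap := h.map_eq_gaussianReal (Real.exp_pos k).le
      rw [hdiag] at hmap
      simp only [mul_zero, ne_eq, OfNat.ofNat_ne_zero, not_false_eq_true, zero_pow,
        Real.toNNReal_zero, gaussianReal_zero_var] at hmap
      have : ∀ᵐ x ∂P.map (X (Real.exp k)), x = 0 := by
        rw [hmap, ae_dirac_eq]
        exact rfl
      exact ae_of_ae_map (h.1 _).aemeasurable this
    filter_upwards [hzero] with ω hω
    refine hexp.frequently (Frequently.of_forall fun k => ?_)
    rw [hω, zero_div]
    linarith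
  obtain ⟨a, ha, ha1⟩ := exists_between (max_lt one_pos (sub_lt_self 1 (div_pos hε hσ)))
  have ha0 : 0 < a := (le_max_left _ _).trans_lt ha
  have haσ : σ - ε ≤ a * σ := by
    have := ((le_max_right _ _).trans_lt ha).le
    rw [sub_le_iff_le_add, ← sub_le_iff_le_add', le_div_iff₀ hσ] at this
    linarith
  let b : ℕ → ℝ := fun k => (Real.exp k ^ ρ * σ)⁻¹
  have hb (k : ℕ) : 0 < b k :=
    inv_pos.2 (mul_pos (Real.rpow_pos_of_pos (Real.exp_pos _) _) hσ)
  obtain ⟨C, hC, hCbound⟩ := (hdecay.comp_tendsto hexp).exists_pos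
  obtain ⟨n₀, hn₀⟩ := eventually_atTop.1 hCbound.bound
  have hfreq := ae_frequently_lt_of_covariance_le_rpow (P := P) (n₀ := n₀)
    (ξ := fun k ω => b k * X (Real.exp k) ω) (fun k => (h.1 _).const_mul _) (fun i j => ?_)
    (fun k => ?_) (C := C / σ ^ 2) (by positivity) hη (fun n hn i => ?_) ha0 ha1
  · filter_upwards [hfreq] with ω hω
    refine hexp.frequently (hω.mp ((eventually_gt_atTop 1).mono fun k hk hlt => ?_))
    have hk' : 0 < Real.log k := Real.log_pos (by exact_mod_cast hk)
    have hck : 0 < Real.exp k ^ ρ := Real.rpow_pos_of_pos (Real.exp_pos _) _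
    have hsqrt : √(2 * Real.exp k ^ (2 * ρ) * Real.log (Real.log (Real.exp k))) =
        Real.exp k ^ ρ * √(2 * Real.log k) := by
      rw [Real.log_exp, mul_comm 2 ρ, Real.rpow_mul (Real.exp_pos _).le, Real.rpow_two,
        mul_comm 2, mul_assoc, Real.sqrt_mul (sq_nonneg _), Real.sqrt_sq hck.le]
    rw [hsqrt, le_div_iff₀ (by positivity)]
    simp only [b] at hlt
    rw [← div_eq_inv_mul, lt_div_iff₀ (by positivity)] at hlt
    calc (σ - ε) * (Real.exp k ^ ρ * √(2 * Real.log k))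
        ≤ a * σ * (Real.exp k ^ ρ * √(2 * Real.log k)) := by gcongr
      _ = a * √(2 * Real.log k) * (Real.exp k ^ ρ * σ) := by ring
      _ ≤ X (Real.exp k) ω := hlt.le
  · exact (h.hasGaussianLaw_prodMk (Real.exp_pos _).le (Real.exp_pos _).le).map_fun
      ((b i • ContinuousLinearMap.fst ℝ ℝ ℝ).prod (b j • ContinuousLinearMap.snd ℝ ℝ ℝ))
  · have := congr_arg (Measure.map (b k * ·)) (h.map_eq_gaussianReal (Real.exp_pos k).le)
    rw [Measure.map_map (by fun_prop) (h.1 _), gaussianReal_map_const_mul, mul_zero, hdiag] at this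
    refine this.trans ?_
    congr 1
    ext
    have hk := hb k
    simp only [NNReal.coe_mul, NNReal.coe_mk, Real.coe_toNNReal _ (sq_nonneg _), NNReal.coe_one]
    rw [← mul_pow, inv_mul_cancel₀ (inv_pos.1 hk).ne', one_pow]
  · have hcross := hss (Real.exp i) (Real.exp_pos _) 1 one_pos (Real.exp n) (Real.exp_pos _)
    rw [mul_one, ← Real.exp_add, ← Nat.cast_add] at hcross
    rw [covariance_const_mul_left, covariance_const_mul_right,
      h.covariance_eq (Real.exp_pos _).le (Real.exp_pos _).le, hcross]
    have hn' := hn₀ n hn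
    simp only [Function.comp_apply, Real.log_exp, Real.norm_eq_abs] at hn'
    rw [abs_of_nonneg (Real.rpow_nonneg (Nat.cast_nonneg n) _)] at hn'
    have hscale : b i * (b (i + n) * (Real.exp i ^ (2 * ρ) * ∫ ω, X 1 ω * X (Real.exp n) ω ∂P)) =
        (Real.exp n ^ (-ρ) * ∫ ω, X 1 ω * X (Real.exp n) ω ∂P) / σ ^ 2 := by
      simp only [b]
      rw [Nat.cast_add, Real.exp_add, Real.mul_rpow (Real.exp_pos _).le (Real.exp_pos _).le,
        two_mul, Real.rpow_add (Real.exp_pos _), Real.rpow_neg (Real.exp_pos _).le]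
      have := Real.rpow_pos_of_pos (Real.exp_pos i) ρ
      have := Real.rpow_pos_of_pos (Real.exp_pos n) ρ
      field_simp
    rw [hscale, abs_div, abs_of_pos (pow_pos hσ 2), div_mul_eq_mul_div]
    gcongr

/-- The law of the iterated logarithm for the upper envelope. -/
lemma ae_limsup_div_eq (h : IsCenteredGaussianProcess P X) (hρ : 0 < ρ)
    (hcont : ∀ᵐ ω ∂P, ContinuousOn (fun s : ℝ => X s ω) (Set.Ici 0))
    (hss : ∀ c > 0, ∀ s > 0, ∀ t > 0,
      ∫ ω, X (c * s) ω * X (c * t) ω ∂P = c ^ (2 * ρ) * ∫ ω, X s ω * X t ω ∂P)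
    {η : ℝ} (hη : 0 < η)
    (hdecay : (fun x : ℝ => x ^ (-ρ) * ∫ ω, X 1 ω * X x ω ∂P) =O[atTop]
      fun x : ℝ => Real.log x ^ (-η)) :
    ∀ᵐ ω ∂P, limsup (fun s : ℝ => X s ω / √(2 * s ^ (2 * ρ) * Real.log (Real.log s))) atTop =
      √(∫ ω, X 1 ω * X 1 ω ∂P) := by
  set σ : ℝ := √(∫ ω, X 1 ω * X 1 ω ∂P)
  have hσ0 : 0 ≤ σ := Real.sqrt_nonneg _
  have hvar : ∫ ω, X 1 ω * X 1 ω ∂P = σ ^ 2 :=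
    (Real.sq_sqrt (integral_nonneg fun ω => mul_self_nonneg _)).symm
  have hup := ae_all_iff.2 fun n : ℕ =>
    h.ae_eventually_div_le hρ hcont hss hσ0 hvar (Nat.one_div_pos_of_nat (n := n))
  have hlow := ae_all_iff.2 fun n : ℕ =>
    h.ae_frequently_le_div hss hη hdecay hσ0 hvar (Nat.one_div_pos_of_nat (n := n))
  filter_upwards [hup, hlow] with ω hωup hωlow
  have hlim := tendsto_one_div_add_atTop_nhds_zero_nat (𝕜 := ℝ)
  refine le_antisymm ?_ ?_
  · refine ge_of_tendsto' (x := atTop) (f := fun n : ℕ => σ + 2 * (1 / ((n : ℝ) + 1))) ?_ fun n =>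
      limsup_le_of_le (IsCoboundedUnder.of_frequently_ge (hωlow 0)) (hωup n)
    simpa using (hlim.const_mul 2).const_add σ
  · refine le_of_tendsto' (x := atTop) (f := fun n : ℕ => σ - 1 / ((n : ℝ) + 1)) ?_ fun n =>
      le_limsup_of_frequently_le (hωlow n) (isBoundedUnder_of_eventually_le (hωup 0))
    simpa using hlim.const_sub σ

end IsCenteredGaussianProcess

end

/-- Theorem 2 (main LIL): if the covariance kernel is self-similar with exponent `ρ > 0`
and `h(x) = x^{-ρ} R(1,x) = O((log x)^{-η})` for some `η > 0`, then a.s.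
`limsup_{s→∞} ± X(s)/√(2 s^{2ρ} log log s) = R(1,1)^{1/2}`. -/
theorem lil_selfsimilar_gaussian {Ω : Type*} [MeasurableSpace Ω] (P : Measure Ω)
    [IsProbabilityMeasure P] (X : ℝ → Ω → ℝ) (R : ℝ → ℝ → ℝ) (ρ η : ℝ)
    (hρ : 0 < ρ) (hη : 0 < η)
    (hGauss : IsCenteredGaussianProcess P X)
    (hcont : ∀ᵐ ω ∂P, ContinuousOn (fun s : ℝ => X s ω) (Set.Ici (0 : ℝ)))
    (hR : ∀ s t : ℝ, 0 ≤ s → 0 ≤ t → R s t = ∫ ω, X s ω * X t ω ∂P)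
    (hss : ∀ c > (0 : ℝ), ∀ s > (0 : ℝ), ∀ t > (0 : ℝ),
      R (c * s) (c * t) = c ^ (2 * ρ) * R s t)
    (hdecay : (fun x : ℝ => x ^ (-ρ) * R 1 x) =O[atTop]
      fun x : ℝ => Real.log x ^ (-η)) :
    ∀ᵐ ω ∂P,
      limsup (fun s : ℝ =>
          X s ω / Real.sqrt (2 * s ^ (2 * ρ) * Real.log (Real.log s))) atTop
        = Real.sqrt (R 1 1) ∧
      limsup (fun s : ℝ =>
          (-X s ω) / Real.sqrt (2 * s ^ (2 * ρ) * Real.log (Real.log s))) atTop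
        = Real.sqrt (R 1 1) := by
  have hss' : ∀ c > 0, ∀ s > 0, ∀ t > 0,
      ∫ ω, X (c * s) ω * X (c * t) ω ∂P = c ^ (2 * ρ) * ∫ ω, X s ω * X t ω ∂P := by
    intro c hc s hs t ht
    rw [← hR _ _ (mul_pos hc hs).le (mul_pos hc ht).le, ← hR _ _ hs.le ht.le]
    exact hss c hc s hs t ht
  have hdecay' : (fun x : ℝ => x ^ (-ρ) * ∫ ω, X 1 ω * X x ω ∂P) =O[atTop]
      fun x : ℝ => Real.log x ^ (-η) := by
    refine hdecay.congr' ?_ EventuallyEq.rfl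
    filter_upwards [eventually_ge_atTop 0] with x hx
    rw [hR 1 x zero_le_one hx]
  rw [hR 1 1 zero_le_one zero_le_one]
  have hpos := hGauss.ae_limsup_div_eq hρ hcont hss' hη hdecay'
  have hneg := hGauss.neg.ae_limsup_div_eq hρ (hcont.mono fun ω hω => hω.neg)
    (by simpa only [neg_mul_neg] using hss') hη (by simpa only [neg_mul_neg] using hdecay')
  simp only [neg_mul_neg] at hneg
  filter_upwards [hpos, hneg] with ω h1 h2 using ⟨h1, h2⟩
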